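/- Let n ≥ 1 and let f_1,…,f_n : ℝ^d → ℝ be differentiable, with f_i being μ_i-strongly convex for some μ_i > 0. Let x⋆ be the unique minimizer of f := (1/n)Σ_{i=1}^n f_i. Let 𝒮 be a proper, nonvacuous sampling over the subsets of [n], and define μ_AS := min_{C ⊆ [n], p_C > 0} Σ_{i∈C} μ_i/(n p_i) and σ²_{⋆,AS} := Σ_{C ⊆ [n], p_C > 0} p_C ‖∇f_C(x⋆)‖². Let x_0 ∈ ℝ^d be deterministic, let (S_t)_{t≥0} be independent random sets each distributed according to 𝒮, and define the stochastic proximal point iterates x_{t+1} := prox_{γ f_{S_t}}(x_t). Then for every t ≥ 0 and every γ > 0, E[‖x_t − x⋆‖²] ≤ (1/(1 + γμ_AS))^{2t}·‖x_0 − x⋆‖² + γσ²_{⋆,AS}/(γμ_AS² + 2μ_AS). -/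

import Mathlib

open RealInnerProductSpace

section Proximal

variable {E : Type*} [NormedAddCommGroup E] [InnerProductSpace ℝ E]

/-- A weighted sum of functions with gradients has the weighted sum of the gradients. -/
theorem hasGradientAt_sum_mul [CompleteSpace E] {ι : Type*} (s : Finset ι) (w : ι → ℝ)
    {f : ι → E → ℝ} {f' : ι → E} {y : E} (h : ∀ i, HasGradientAt (f i) (f' i) y) :
    HasGradientAt (fun z => ∑ i ∈ s, w i * f i z) (∑ i ∈ s, w i • f' i) y := by
  rw [hasGradientAt_iff_hasFDerivAt, map_sum]
  refine HasFDerivAt.fun_sum fun i _ => ?_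
  rw [map_smul]
  exact (h i).hasFDerivAt.const_mul (w i)

/-- At a global minimizer the gradient vanishes. -/
theorem gradient_eq_zero_of_forall_le [CompleteSpace E] {F : E → ℝ} {g y : E}
    (h : HasGradientAt F g y)
    (hmin : ∀ z, F y ≤ F z) : g = 0 := by
  have h0 := IsLocalMin.hasFDerivAt_eq_zero (Filter.Eventually.of_forall hmin) h.hasFDerivAt
  simpa using h0

/-- The optimality condition for the proximity operator. -/
theorem prox_optimality [CompleteSpace E] {F : E → ℝ} {g x y : E} {γ : ℝ} (hγ : 0 < γ)
    (h : HasGradientAt F g y)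
    (hmin : ∀ z, F y + (1 / (2 * γ)) * ‖y - x‖ ^ 2 ≤ F z + (1 / (2 * γ)) * ‖z - x‖ ^ 2) :
    γ • g = x - y := by
  have hq : HasFDerivAt (fun z : E => (1 / (2 * γ)) * ‖z - x‖ ^ 2)
      ((1 / (2 * γ)) • (2 • (innerSL ℝ (y - x)).comp (ContinuousLinearMap.id ℝ E))) y :=
    (((hasFDerivAt_id y).sub_const x).norm_sq).const_mul _
  have h0 := IsLocalMin.hasFDerivAt_eq_zero (Filter.Eventually.of_forall hmin)
    (h.hasFDerivAt.add hq)
  refine ext_inner_right ℝ fun v => ?_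
  have hv : ⟪g, v⟫ + γ⁻¹ * 2⁻¹ * (2 * (⟪y, v⟫ - ⟪x, v⟫)) = 0 := by
    simpa using congrArg (fun L : E →L[ℝ] ℝ => L v) h0
  rw [real_inner_smul_left, inner_sub_left]
  field_simp at hv
  linarith

/-- Weighted sums of gradients of strongly convex functions are strongly monotone. -/
theorem inner_sum_smul_sub_ge {ι : Type*} (s : Finset ι) {w μ : ι → ℝ} (hw : ∀ i, 0 ≤ w i)
    {f : ι → E → ℝ} {f' : ι → E → E}
    (hsc : ∀ i y z, f i y + ⟪f' i y, z - y⟫ + μ i / 2 * ‖z - y‖ ^ 2 ≤ f i z) (y z : E) :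
    (∑ i ∈ s, w i * μ i) * ‖y - z‖ ^ 2 ≤
      ⟪∑ i ∈ s, w i • f' i y - ∑ i ∈ s, w i • f' i z, y - z⟫ := by
  rw [← Finset.sum_sub_distrib, sum_inner, Finset.sum_mul]
  refine Finset.sum_le_sum fun i _ => ?_
  have h1 := hsc i y z
  have h2 := hsc i z y
  rw [← neg_sub y z, inner_neg_right, norm_neg] at h1
  rw [← smul_sub, real_inner_smul_left, inner_sub_left, mul_assoc]
  exact mul_le_mul_of_nonneg_left (by linarith) (hw i)

/-- One proximal step contracts the distance to `z` up to the gradient `h` at `z`. -/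
theorem prox_step_sq_le {g h x y z : E} {γ m μ : ℝ} (hγ : 0 < γ) (hμ : 0 ≤ μ) (hm : μ ≤ m)
    (hopt : γ • g = x - y) (hmono : m * ‖y - z‖ ^ 2 ≤ ⟪g - h, y - z⟫) :
    (1 + γ * μ) ^ 2 * ‖y - z‖ ^ 2 ≤
      ‖x - z‖ ^ 2 - 2 * γ * ⟪h, x - z⟫ + γ ^ 2 * ‖h‖ ^ 2 := by
  have hμ' : μ * ‖y - z‖ ^ 2 ≤ ⟪g - h, y - z⟫ :=
    (mul_le_mul_of_nonneg_right hm (sq_nonneg _)).trans hmono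
  have hsplit : x - z - γ • h = (y - z) + γ • (g - h) := by
    rw [smul_sub, hopt]; abel
  have hinner : (1 + γ * μ) * ‖y - z‖ ^ 2 ≤ ⟪x - z - γ • h, y - z⟫ := by
    rw [hsplit, inner_add_left, real_inner_smul_left, real_inner_self_eq_norm_sq]
    nlinarith [mul_le_mul_of_nonneg_left hμ' hγ.le]
  have hnorm : (1 + γ * μ) * ‖y - z‖ ≤ ‖x - z - γ • h‖ := by
    rcases (norm_nonneg (y - z)).eq_or_lt with h0 | h0
    · rw [← h0, mul_zero]; exact norm_nonneg _
    · refine le_of_mul_le_mul_right ?_ h0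
      calc _ = (1 + γ * μ) * ‖y - z‖ ^ 2 := by ring
        _ ≤ _ := hinner.trans (real_inner_le_norm _ _)
  have hexp : ‖x - z - γ • h‖ ^ 2 = ‖x - z‖ ^ 2 - 2 * γ * ⟪h, x - z⟫ + γ ^ 2 * ‖h‖ ^ 2 := by
    rw [norm_sub_sq_real, real_inner_smul_right, norm_smul, mul_pow, Real.norm_eq_abs, sq_abs,
      real_inner_comm]
    ring
  rw [← hexp, ← mul_pow]
  exact pow_le_pow_left₀ (by positivity) hnorm 2

end Proximal

/-- The importance-weighted sum over a random set is an unbiased estimator of the full sum. -/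
theorem sum_prob_smul_sum_inv_smul {ι V : Type*} [Fintype ι] [DecidableEq ι] [AddCommGroup V]
    [Module ℝ V] {p : Finset ι → ℝ} {q : ι → ℝ}
    (hq : ∀ i, q i = ∑ S ∈ Finset.univ.filter (fun S : Finset ι => i ∈ S), p S)
    (hq0 : ∀ i, q i ≠ 0) (c : ℝ) (v : ι → V) :
    ∑ S : Finset ι, p S • ∑ i ∈ S, (c * q i)⁻¹ • v i = ∑ i, c⁻¹ • v i := by
  have hS : ∀ S : Finset ι, p S • ∑ i ∈ S, (c * q i)⁻¹ • v i =
      ∑ i, (if i ∈ S then p S else 0) • (c * q i)⁻¹ • v i := fun S => by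
    simp [Finset.smul_sum, ite_smul, Finset.sum_ite_mem]
  rw [Finset.sum_congr rfl fun S _ => hS S, Finset.sum_comm]
  refine Finset.sum_congr rfl fun i _ => ?_
  rw [← Finset.sum_smul, ← Finset.sum_filter, ← hq i, smul_smul, mul_inv, mul_left_comm,
    mul_inv_cancel₀ (hq0 i), mul_one]

/-- Summation over histories of length `t + 1`, conditioning on the first `t` entries. -/
theorem sum_prod_snoc {α : Type*} [Fintype α] (t : ℕ) (p : α → ℝ)
    (F : (Fin t → α) → α → ℝ) :
    ∑ σ : Fin (t + 1) → α, (∏ j, p (σ j)) * F (fun j => σ j.castSucc) (σ (Fin.last t)) =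
      ∑ τ : Fin t → α, (∏ j, p (τ j)) * ∑ a, p a * F τ a := by
  rw [← (Fin.snocEquiv fun _ => α).sum_comp, Fintype.sum_prod_type, Finset.sum_comm]
  refine Finset.sum_congr rfl fun τ _ => ?_
  rw [Finset.mul_sum]
  refine Finset.sum_congr rfl fun a _ => ?_
  simp [Fin.snocEquiv, Fin.prod_univ_castSucc, mul_assoc]

/-- The product weights on histories have total mass one. -/
theorem sum_prod_eq_one {α : Type*} [Fintype α] (t : ℕ) {p : α → ℝ} (hp : ∑ a, p a = 1) :
    ∑ τ : Fin t → α, ∏ j, p (τ j) = 1 := by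
  classical
  rw [← Fintype.piFinset_univ, ← Finset.prod_univ_sum]
  simp [hp]

/-- Convergence of SPPM-AS (stochastic proximal point method with arbitrary sampling):
with i.i.d. sampled cohorts `S_t ~ 𝒮` (encoded by summing over all finite histories with
their product probabilities), the iterates `x_{t+1} = prox_{γ f_{S_t}}(x_t)` satisfy
`E‖x_t - x⋆‖² ≤ (1/(1+γμ_AS))^{2t}‖x_0 - x⋆‖² + γσ²_{⋆,AS}/(γμ_AS² + 2μ_AS)`. -/
theorem sppm_as_convergence
    {n d : ℕ} (hn : 1 ≤ n)
    (f : Fin n → EuclideanSpace ℝ (Fin d) → ℝ)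
    (f' : Fin n → EuclideanSpace ℝ (Fin d) → EuclideanSpace ℝ (Fin d))
    (hdiff : ∀ i y, HasGradientAt (f i) (f' i y) y)
    (μs : Fin n → ℝ) (hμpos : ∀ i, 0 < μs i)
    (hsc : ∀ (i : Fin n) (y z : EuclideanSpace ℝ (Fin d)),
      f i y + ⟪f' i y, z - y⟫ + μs i / 2 * ‖z - y‖ ^ 2 ≤ f i z)
    (xstar : EuclideanSpace ℝ (Fin d))
    (hmin : ∀ y, (n : ℝ)⁻¹ * ∑ i, f i xstar ≤ (n : ℝ)⁻¹ * ∑ i, f i y)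
    -- the sampling distribution 𝒮, nonvacuous and proper
    (p : Finset (Fin n) → ℝ) (hp0 : ∀ S, 0 ≤ p S)
    (hp1 : ∑ S : Finset (Fin n), p S = 1) (hvac : p ∅ = 0)
    (pc : Fin n → ℝ)
    (hpc : ∀ i, pc i = ∑ S ∈ Finset.univ.filter (fun S : Finset (Fin n) => i ∈ S), p S)
    (hproper : ∀ i, 0 < pc i)
    -- μ_AS, the minimum over admissible cohorts
    (μAS : ℝ)
    (hμAS_le : ∀ S : Finset (Fin n), 0 < p S → μAS ≤ ∑ i ∈ S, μs i / ((n : ℝ) * pc i))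
    (hμAS_mem : ∃ S : Finset (Fin n), 0 < p S ∧ μAS = ∑ i ∈ S, μs i / ((n : ℝ) * pc i))
    -- σ²_{⋆,AS}
    (σ2 : ℝ)
    (hσ2 : σ2 = ∑ S : Finset (Fin n), p S * ‖∑ i ∈ S, ((n : ℝ) * pc i)⁻¹ • f' i xstar‖ ^ 2)
    -- the stepsize and the proximity operator of γ f_C
    (γ : ℝ) (hγ : 0 < γ)
    (prox : Finset (Fin n) → EuclideanSpace ℝ (Fin d) → EuclideanSpace ℝ (Fin d))
    (hprox : ∀ S : Finset (Fin n), 0 < p S → ∀ x z : EuclideanSpace ℝ (Fin d),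
      (∑ i ∈ S, ((n : ℝ) * pc i)⁻¹ * f i (prox S x)) + (1 / (2 * γ)) * ‖prox S x - x‖ ^ 2 ≤
        (∑ i ∈ S, ((n : ℝ) * pc i)⁻¹ * f i z) + (1 / (2 * γ)) * ‖z - x‖ ^ 2)
    -- the iterates, as a function of the history of sampled cohorts
    (x0 : EuclideanSpace ℝ (Fin d))
    (X : (t : ℕ) → (Fin t → Finset (Fin n)) → EuclideanSpace ℝ (Fin d))
    (hX0 : ∀ σ, X 0 σ = x0)
    (hXrec : ∀ (t : ℕ) (σ : Fin (t + 1) → Finset (Fin n)),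
      X (t + 1) σ = prox (σ (Fin.last t)) (X t (fun j => σ j.castSucc))) :
    ∀ t : ℕ,
      (∑ σ : Fin t → Finset (Fin n), (∏ j, p (σ j)) * ‖X t σ - xstar‖ ^ 2) ≤
        (1 / (1 + γ * μAS)) ^ (2 * t) * ‖x0 - xstar‖ ^ 2 +
          γ * σ2 / (γ * μAS ^ 2 + 2 * μAS) := by
  classical
  have hn0 : (0 : ℝ) < n := by exact_mod_cast hn
  have hw : ∀ i, 0 < ((n : ℝ) * pc i)⁻¹ := fun i => inv_pos.2 (mul_pos hn0 (hproper i))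
  have hμ : 0 < μAS := by
    obtain ⟨S, hS, rfl⟩ := hμAS_mem
    have hne : S.Nonempty := by
      rw [Finset.nonempty_iff_ne_empty]
      rintro rfl
      exact hS.ne' hvac
    exact Finset.sum_pos (fun i _ => div_pos (hμpos i) (mul_pos hn0 (hproper i))) hne
  set h : Finset (Fin n) → EuclideanSpace ℝ (Fin d) :=
    fun S => ∑ i ∈ S, ((n : ℝ) * pc i)⁻¹ • f' i xstar with h_def
  have hmean : ∑ S, p S • h S = 0 := by
    rw [h_def, sum_prob_smul_sum_inv_smul hpc (fun i => (hproper i).ne')]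
    refine gradient_eq_zero_of_forall_le
      (hasGradientAt_sum_mul Finset.univ (fun _ => (n : ℝ)⁻¹) fun i => hdiff i xstar) fun z => ?_
    simpa [Finset.mul_sum] using hmin z
  have hstep : ∀ S, 0 < p S → ∀ x, (1 + γ * μAS) ^ 2 * ‖prox S x - xstar‖ ^ 2 ≤
      ‖x - xstar‖ ^ 2 - 2 * γ * ⟪h S, x - xstar⟫ + γ ^ 2 * ‖h S‖ ^ 2 := fun S hS x => by
    refine prox_step_sq_le hγ hμ.le (hμAS_le S hS)
      (prox_optimality hγ (hasGradientAt_sum_mul S _ fun i => hdiff i (prox S x))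
        (hprox S hS x)) ?_
    have hmono := inner_sum_smul_sub_ge S (fun i => (hw i).le) hsc (prox S x) xstar
    simpa only [div_eq_inv_mul] using hmono
  have hcond : ∀ x, (1 + γ * μAS) ^ 2 * ∑ S, p S * ‖prox S x - xstar‖ ^ 2 ≤
      ‖x - xstar‖ ^ 2 + γ ^ 2 * σ2 := fun x => by
    have hcross : ∑ S, p S * ⟪h S, x - xstar⟫ = 0 := by
      simp_rw [← real_inner_smul_left]
      rw [← sum_inner, hmean, inner_zero_left]
    calc (1 + γ * μAS) ^ 2 * ∑ S, p S * ‖prox S x - xstar‖ ^ 2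
        = ∑ S, p S * ((1 + γ * μAS) ^ 2 * ‖prox S x - xstar‖ ^ 2) := by
          rw [Finset.mul_sum]
          exact Finset.sum_congr rfl fun S _ => mul_left_comm _ _ _
      _ ≤ ∑ S, p S * (‖x - xstar‖ ^ 2 - 2 * γ * ⟪h S, x - xstar⟫ + γ ^ 2 * ‖h S‖ ^ 2) := by
          refine Finset.sum_le_sum fun S _ => ?_
          rcases (hp0 S).eq_or_lt with h0 | h0
          · simp [← h0]
          · exact mul_le_mul_of_nonneg_left (hstep S h0 x) h0.le
      _ = (∑ S, p S) * ‖x - xstar‖ ^ 2 - 2 * γ * (∑ S, p S * ⟪h S, x - xstar⟫) +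
            γ ^ 2 * ∑ S, p S * ‖h S‖ ^ 2 := by
          rw [Finset.sum_mul, Finset.mul_sum, Finset.mul_sum, ← Finset.sum_sub_distrib,
            ← Finset.sum_add_distrib]
          exact Finset.sum_congr rfl fun S _ => by ring
      _ = ‖x - xstar‖ ^ 2 + γ ^ 2 * σ2 := by
          rw [hp1, hcross, hσ2]; ring
  have hA : 0 < (1 + γ * μAS) ^ 2 := by positivity
  intro t
  induction t with
  | zero =>
    have hσ2_nonneg : 0 ≤ σ2 := by
      rw [hσ2]
      exact Finset.sum_nonneg fun S _ => mul_nonneg (hp0 S) (sq_nonneg _)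
    have hnoise : 0 ≤ γ * σ2 / (γ * μAS ^ 2 + 2 * μAS) := by positivity
    simpa [hX0] using hnoise
  | succ t ih =>
    have hrec : (1 + γ * μAS) ^ 2 *
        ∑ σ : Fin (t + 1) → Finset (Fin n), (∏ j, p (σ j)) * ‖X (t + 1) σ - xstar‖ ^ 2 ≤
        (∑ σ : Fin t → Finset (Fin n), (∏ j, p (σ j)) * ‖X t σ - xstar‖ ^ 2) + γ ^ 2 * σ2 := by
      simp_rw [hXrec]
      rw [sum_prod_snoc t p fun τ S => ‖prox S (X t τ) - xstar‖ ^ 2, Finset.mul_sum]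
      calc _ ≤ ∑ τ : Fin t → Finset (Fin n), (∏ j, p (τ j)) *
            (‖X t τ - xstar‖ ^ 2 + γ ^ 2 * σ2) := by
            refine Finset.sum_le_sum fun τ _ => ?_
            rw [mul_left_comm]
            exact mul_le_mul_of_nonneg_left (hcond _) (Finset.prod_nonneg fun j _ => hp0 _)
        _ = _ := by
            simp_rw [mul_add]
            rw [Finset.sum_add_distrib, ← Finset.sum_mul, sum_prod_eq_one t hp1, one_mul]
    refine le_of_mul_le_mul_left (hrec.trans ((add_le_add_left ih _).trans_eq ?_)) hA
    have hB : γ * μAS ^ 2 + 2 * μAS ≠ 0 := by positivity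
    have hpow : (1 + γ * μAS) ^ 2 * (1 / (1 + γ * μAS)) ^ (2 * (t + 1)) =
        (1 / (1 + γ * μAS)) ^ (2 * t) := by
      have h1 : (1 + γ * μAS) ≠ 0 := by positivity
      rw [mul_add, pow_add, mul_one, one_div, inv_pow _ 2, mul_left_comm,
        mul_inv_cancel₀ hA.ne', mul_one]
    rw [mul_add, ← mul_assoc, hpow, add_assoc]
    congr 1
    field_simp
    ring
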